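/- Let p be a closed quantity term such that (1+p)/(1+p) = 1 is valid in D, and let a and b be distinct transfer actions with a ≠ ι and b ≠ ι. Then the equation ε^p_{a}(a(u) ⊓ σ(a(5)) ⊓ σ²(b(u − 7))) = γ(u + 5/(1+p)) ⊓ σ²(b(u − 7)) is derivable from the axioms of TTC together with the proof rule DE, where u is a quantity variable and 5 and 7 abbreviate the corresponding sums of 1's. -/

import Mathlib

/-- A signed non-trivial cancellation meadow: a commutative ring with `0 ≠ 1`,
a total multiplicative inverse operation satisfying reflexivity and the restricted
inverse law, the cancellation axiom, and a signum operation satisfying the signum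
axioms.  (`u / v` abbreviates `u * minv v`.) -/
structure SignedCancellationMeadow (D : Type) [CommRing D] where
  minv : D → D
  sgn : D → D
  inv_inv : ∀ u : D, minv (minv u) = u
  ril : ∀ u : D, u * (u * minv u) = u
  cancel : ∀ u v w : D, u ≠ 0 → u * v = u * w → v = w
  zero_ne_one : (0 : D) ≠ 1
  sgn_div_self : ∀ u : D, sgn (u * minv u) = u * minv u
  sgn_one_sub_div_self : ∀ u : D, sgn (1 - u * minv u) = 1 - u * minv u
  sgn_neg_one : sgn (-1) = -1
  sgn_inv : ∀ u : D, sgn (minv u) = sgn u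
  sgn_mul : ∀ u v : D, sgn (u * v) = sgn u * sgn v
  sgn_add : ∀ u v : D,
    (1 - (sgn u - sgn v) * minv (sgn u - sgn v)) * (sgn (u + v) - sgn u) = 0

mutual
/-- Quantity terms of TTC: built from `0`, `1`, `+`, `·`, additive inverse,
multiplicative inverse, signum, quantity variables, and the implicit capital
operator `ic_u(x)`. -/
inductive QT (A : Type) : Type where
  | zero : QT A
  | one : QT A
  | add : QT A → QT A → QT A
  | mul : QT A → QT A → QT A
  | neg : QT A → QT A
  | inv : QT A → QT A
  | sgn : QT A → QT A
  | var : ℕ → QT A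
  | ic : QT A → TT A → QT A

/-- TTC terms of sort Tuplix over the set `A` of transfer actions: the empty tuplix
`ε`, the blocking tuplix `δ`, transfer actions `a(p)`, zero tests `γ(p)`, tuplix
variables, conjunctive composition `⊓`, delay `σ`, pre-abstraction `τ_I`, and
interest counting encapsulation `ε^u_H`. -/
inductive TT (A : Type) : Type where
  | eps : TT A
  | dlt : TT A
  | act : A → QT A → TT A
  | gam : QT A → TT A
  | var : ℕ → TT A
  | conj : TT A → TT A → TT A
  | delay : TT A → TT A
  | pabs : Set A → TT A → TT A
  | ienc : Set A → QT A → TT A → TT A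
end

/-- `p / q` for quantity terms abbreviates `p * q⁻¹`. -/
def qdiv {A : Type} (p q : QT A) : QT A := QT.mul p (QT.inv q)

/-- `p − q` for quantity terms abbreviates `p + (−q)`. -/
def qsub {A : Type} (p q : QT A) : QT A := QT.add p (QT.neg q)

/-- `max(p,q)` for quantity terms abbreviates `((s(p−q)+1)/2)·(p−q)+q`. -/
def qmax {A : Type} (p q : QT A) : QT A :=
  QT.add
    (QT.mul (qdiv (QT.add (QT.sgn (qsub p q)) QT.one) (QT.add QT.one QT.one))
      (qsub p q))
    q

/-- The numeral `n` as a quantity term (`2` abbreviates `1+1`, etc.). -/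
def qnum {A : Type} : ℕ → QT A
  | 0 => QT.zero
  | 1 => QT.one
  | (n + 2) => QT.add (qnum (n + 1)) QT.one

/-- A quantity term is `ic`-free if the implicit capital operator does not occur in it. -/
def icFree {A : Type} : QT A → Prop
  | QT.zero => True
  | QT.one => True
  | QT.add p q => icFree p ∧ icFree q
  | QT.mul p q => icFree p ∧ icFree q
  | QT.neg p => icFree p
  | QT.inv p => icFree p
  | QT.sgn p => icFree p
  | QT.var _ => True
  | QT.ic _ _ => False

/-- Evaluation of quantity terms in the signed cancellation meadow `D` under an
assignment `ρ` of elements of `D` to the quantity variables; the implicit capital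
operator is given the junk value `0` (it is only ever used on `ic`-free terms). -/
def evalNoIC {A D : Type} [CommRing D] (M : SignedCancellationMeadow D)
    (ρ : ℕ → D) : QT A → D
  | QT.zero => 0
  | QT.one => 1
  | QT.add p q => evalNoIC M ρ p + evalNoIC M ρ q
  | QT.mul p q => evalNoIC M ρ p * evalNoIC M ρ q
  | QT.neg p => -evalNoIC M ρ p
  | QT.inv p => M.minv (evalNoIC M ρ p)
  | QT.sgn p => M.sgn (evalNoIC M ρ p)
  | QT.var n => ρ n
  | QT.ic _ _ => 0

mutual
/-- Derivability of equations between TTC quantity terms: many-sorted equational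
logic (with the valid `ic`-free quantity equations of `D` usable via rule `valid`)
together with the axioms IC1–IC6 for the implicit capital operator.  `ι` is the
distinguished transfer action used by pre-abstraction. -/
inductive QDer (A : Type) (ι : A) (D : Type) [CommRing D]
    (M : SignedCancellationMeadow D) : QT A → QT A → Prop where
  | refl (p : QT A) : QDer A ι D M p p
  | symm {p q : QT A} : QDer A ι D M p q → QDer A ι D M q p
  | trans {p q r : QT A} : QDer A ι D M p q → QDer A ι D M q r → QDer A ι D M p r
  | add_congr {p p' q q' : QT A} : QDer A ι D M p p' → QDer A ι D M q q' →
      QDer A ι D M (QT.add p q) (QT.add p' q')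
  | mul_congr {p p' q q' : QT A} : QDer A ι D M p p' → QDer A ι D M q q' →
      QDer A ι D M (QT.mul p q) (QT.mul p' q')
  | neg_congr {p p' : QT A} : QDer A ι D M p p' → QDer A ι D M (QT.neg p) (QT.neg p')
  | inv_congr {p p' : QT A} : QDer A ι D M p p' → QDer A ι D M (QT.inv p) (QT.inv p')
  | sgn_congr {p p' : QT A} : QDer A ι D M p p' → QDer A ι D M (QT.sgn p) (QT.sgn p')
  | ic_congr {p p' : QT A} {x x' : TT A} : QDer A ι D M p p' → TDer A ι D M x x' →
      QDer A ι D M (QT.ic p x) (QT.ic p' x')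
  | valid {p q : QT A} : icFree p → icFree q →
      (∀ ρ : ℕ → D, evalNoIC M ρ p = evalNoIC M ρ q) → QDer A ι D M p q
  | ic1 (u : QT A) (x : TT A) :
      QDer A ι D M (QT.ic u x) (QT.ic u (TT.pabs Set.univ x))
  | ic2 (u : QT A) : QDer A ι D M (QT.ic u TT.eps) QT.zero
  | ic3 (u : QT A) : QDer A ι D M (QT.ic u TT.dlt) (QT.neg QT.one)
  | ic4 (u v : QT A) : QDer A ι D M (QT.ic u (TT.act ι v)) (qmax v QT.zero)
  | ic5 (u : QT A) (x : TT A) :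
      QDer A ι D M
        (QT.mul (qdiv (QT.add QT.one (QT.ic u x)) (QT.add QT.one (QT.ic u x)))
          (QT.ic u (TT.delay x)))
        (QT.mul (qdiv (QT.add QT.one (QT.ic u x)) (QT.add QT.one (QT.ic u x)))
          (qmax (QT.mul (qdiv QT.one (QT.add QT.one u)) (QT.ic u x)) QT.zero))
  | ic6 (u v : QT A) (x : TT A) :
      QDer A ι D M
        (QT.mul (qdiv (QT.add QT.one (QT.ic u x)) (QT.add QT.one (QT.ic u x)))
          (QT.ic u (TT.conj (TT.act ι v) (TT.delay x))))
        (QT.mul (qdiv (QT.add QT.one (QT.ic u x)) (QT.add QT.one (QT.ic u x)))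
          (qmax (QT.add v (QT.mul (qdiv QT.one (QT.add QT.one u)) (QT.ic u x)))
            QT.zero))

/-- Derivability of equations between TTC tuplix terms: many-sorted equational logic
together with the axioms T1–T10, D1–D4, PA1–PA8, RICA and ICE1–ICE8 and the proof
rule DE (rule `gam_congr` combined with rule `valid` of `QDer`).  `ι` is the
distinguished transfer action used by pre-abstraction. -/
inductive TDer (A : Type) (ι : A) (D : Type) [CommRing D]
    (M : SignedCancellationMeadow D) : TT A → TT A → Prop where
  | refl (x : TT A) : TDer A ι D M x x
  | symm {x y : TT A} : TDer A ι D M x y → TDer A ι D M y x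
  | trans {x y z : TT A} : TDer A ι D M x y → TDer A ι D M y z → TDer A ι D M x z
  | act_congr (a : A) {p q : QT A} : QDer A ι D M p q →
      TDer A ι D M (TT.act a p) (TT.act a q)
  | gam_congr {p q : QT A} : QDer A ι D M p q →
      TDer A ι D M (TT.gam p) (TT.gam q)
  | conj_congr {x x' y y' : TT A} : TDer A ι D M x x' → TDer A ι D M y y' →
      TDer A ι D M (TT.conj x y) (TT.conj x' y')
  | delay_congr {x x' : TT A} : TDer A ι D M x x' →
      TDer A ι D M (TT.delay x) (TT.delay x')
  | pabs_congr (I : Set A) {x x' : TT A} : TDer A ι D M x x' →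
      TDer A ι D M (TT.pabs I x) (TT.pabs I x')
  | ienc_congr (H : Set A) {p q : QT A} {x x' : TT A} : QDer A ι D M p q →
      TDer A ι D M x x' → TDer A ι D M (TT.ienc H p x) (TT.ienc H q x')
  | t1 (x y : TT A) : TDer A ι D M (TT.conj x y) (TT.conj y x)
  | t2 (x y z : TT A) :
      TDer A ι D M (TT.conj (TT.conj x y) z) (TT.conj x (TT.conj y z))
  | t3 (x : TT A) : TDer A ι D M (TT.conj x TT.eps) x
  | t4 (x : TT A) : TDer A ι D M (TT.conj x TT.dlt) TT.dlt
  | t5 (a : A) (u v : QT A) :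
      TDer A ι D M (TT.conj (TT.act a u) (TT.act a v)) (TT.act a (QT.add u v))
  | t6 (u : QT A) : TDer A ι D M (TT.gam u) (TT.gam (qdiv u u))
  | t7 : TDer A ι D M (TT.gam QT.zero) TT.eps
  | t8 : TDer A ι D M (TT.gam QT.one) TT.dlt
  | t9 (u v : QT A) :
      TDer A ι D M (TT.conj (TT.gam u) (TT.gam v))
        (TT.gam (QT.add (qdiv u u) (qdiv v v)))
  | t10 (a : A) (u v : QT A) :
      TDer A ι D M (TT.conj (TT.gam (qsub u v)) (TT.act a u))
        (TT.conj (TT.gam (qsub u v)) (TT.act a v))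
  | d1 : TDer A ι D M (TT.delay TT.eps) TT.eps
  | d2 : TDer A ι D M (TT.delay TT.dlt) TT.dlt
  | d3 (u : QT A) : TDer A ι D M (TT.delay (TT.gam u)) (TT.gam u)
  | d4 (x y : TT A) :
      TDer A ι D M (TT.delay (TT.conj x y)) (TT.conj (TT.delay x) (TT.delay y))
  | pa1 (I : Set A) : TDer A ι D M (TT.pabs I TT.eps) TT.eps
  | pa2 (I : Set A) : TDer A ι D M (TT.pabs I TT.dlt) TT.dlt
  | pa3 (I : Set A) (u : QT A) : TDer A ι D M (TT.pabs I (TT.gam u)) (TT.gam u)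
  | pa4 (I : Set A) (a : A) (u : QT A) : a ∉ I →
      TDer A ι D M (TT.pabs I (TT.act a u)) (TT.act a u)
  | pa5 (I : Set A) (a : A) (u : QT A) : a ∈ I →
      TDer A ι D M (TT.pabs I (TT.act a u)) (TT.act ι u)
  | pa6 (I : Set A) (x y : TT A) :
      TDer A ι D M (TT.pabs I (TT.conj x y)) (TT.conj (TT.pabs I x) (TT.pabs I y))
  | pa7 (I : Set A) (x : TT A) :
      TDer A ι D M (TT.pabs I (TT.delay x)) (TT.delay (TT.pabs I x))
  | pa8 (I I' : Set A) (x : TT A) :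
      TDer A ι D M (TT.pabs (I ∪ I') x) (TT.pabs I (TT.pabs I' x))
  | rica (a : A) (u v : QT A) (x : TT A) :
      TDer A ι D M
        (TT.conj (TT.gam (qsub QT.one (qdiv (QT.add QT.one u) (QT.add QT.one u))))
          (TT.ienc {a} u (TT.conj (TT.act a v) x)))
        (TT.conj (TT.gam (qsub QT.one (qdiv (QT.add QT.one u) (QT.add QT.one u))))
          (TT.ienc {a} u (TT.conj (TT.delay (TT.act a (QT.mul (QT.add QT.one u) v))) x)))
  | ice1 (H : Set A) (u : QT A) : TDer A ι D M (TT.ienc H u TT.eps) TT.eps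
  | ice2 (H : Set A) (u : QT A) : TDer A ι D M (TT.ienc H u TT.dlt) TT.dlt
  | ice3 (H : Set A) (u v : QT A) : TDer A ι D M (TT.ienc H u (TT.gam v)) (TT.gam v)
  | ice4 (H : Set A) (u : QT A) (a : A) (v : QT A) : a ∉ H →
      TDer A ι D M (TT.ienc H u (TT.act a v)) (TT.act a v)
  | ice5 (H : Set A) (u : QT A) (a : A) (v : QT A) : a ∈ H →
      TDer A ι D M (TT.ienc H u (TT.act a v)) (TT.gam v)
  | ice6 (H : Set A) (u : QT A) (x y : TT A) :
      TDer A ι D M (TT.ienc H u (TT.conj x (TT.ienc H u y)))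
        (TT.conj (TT.ienc H u x) (TT.ienc H u y))
  | ice7 (H : Set A) (u : QT A) (x : TT A) :
      TDer A ι D M (TT.ienc H u (TT.delay x)) (TT.delay (TT.ienc H u x))
  | ice8 (H H' : Set A) (u : QT A) (x : TT A) :
      TDer A ι D M (TT.ienc (H ∪ H') u x) (TT.ienc H u (TT.ienc H' u x))
end

mutual
/-- A TTC quantity term is tuplix-closed if it contains no tuplix variables. -/
def tclosedQ {A : Type} : QT A → Prop
  | QT.zero => True
  | QT.one => True
  | QT.add p q => tclosedQ p ∧ tclosedQ q
  | QT.mul p q => tclosedQ p ∧ tclosedQ q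
  | QT.neg p => tclosedQ p
  | QT.inv p => tclosedQ p
  | QT.sgn p => tclosedQ p
  | QT.var _ => True
  | QT.ic p x => tclosedQ p ∧ tclosedT x

/-- A TTC term of sort Tuplix is tuplix-closed if it contains no tuplix variables. -/
def tclosedT {A : Type} : TT A → Prop
  | TT.eps => True
  | TT.dlt => True
  | TT.act _ p => tclosedQ p
  | TT.gam p => tclosedQ p
  | TT.var _ => False
  | TT.conj x y => tclosedT x ∧ tclosedT y
  | TT.delay x => tclosedT x
  | TT.pabs _ x => tclosedT x
  | TT.ienc _ p x => tclosedQ p ∧ tclosedT x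
end

/-- The term `γ(p₀) ⊓ a₁(p₁) ⊓ … ⊓ a_k(p_k) ⊓ x₁ ⊓ … ⊓ x_l` (associated to the left),
where `as = [(a₁,p₁),…,(a_k,p_k)]` and `xs = [x₁,…,x_l]`. -/
def mkCanon {A : Type} (p0 : QT A) (as : List (A × QT A)) (xs : List ℕ) : TT A :=
  ((as.map fun ap : A × QT A => TT.act ap.1 ap.2) ++ (xs.map TT.var)).foldl TT.conj
    (TT.gam p0)

/-- A CTC canonical term: a term of the form
`γ(p₀) ⊓ a₁(p₁) ⊓ … ⊓ a_k(p_k) ⊓ x₁ ⊓ … ⊓ x_l` with `k, l ≥ 0` and `a₁, …, a_k`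
distinct transfer actions. -/
def IsCTCCanonical {A : Type} (t : TT A) : Prop :=
  ∃ (p0 : QT A) (as : List (A × QT A)) (xs : List ℕ),
    (as.map Prod.fst).Nodup ∧ t = mkCanon p0 as xs

/-- A TTC canonical term: either a CTC canonical term, or `t ⊓ σ(t')` with `t` a
CTC canonical term and `t'` a TTC canonical term. -/
inductive IsTTCCanonical {A : Type} : TT A → Prop where
  | base {t : TT A} : IsCTCCanonical t → IsTTCCanonical t
  | step {t t' : TT A} : IsCTCCanonical t → IsTTCCanonical t' →
      IsTTCCanonical (TT.conj t (TT.delay t'))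

mutual
/-- A TTC quantity term is closed if it contains no variables (of either sort). -/
def closedQ {A : Type} : QT A → Prop
  | QT.zero => True
  | QT.one => True
  | QT.add p q => closedQ p ∧ closedQ q
  | QT.mul p q => closedQ p ∧ closedQ q
  | QT.neg p => closedQ p
  | QT.inv p => closedQ p
  | QT.sgn p => closedQ p
  | QT.var _ => False
  | QT.ic p x => closedQ p ∧ closedT x

/-- A TTC term of sort Tuplix is closed if it contains no variables (of either sort). -/
def closedT {A : Type} : TT A → Prop
  | TT.eps => True
  | TT.dlt => True
  | TT.act _ p => closedQ p
  | TT.gam p => closedQ p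
  | TT.var _ => False
  | TT.conj x y => closedT x ∧ closedT y
  | TT.delay x => closedT x
  | TT.pabs _ x => closedT x
  | TT.ienc _ p x => closedQ p ∧ closedT x
end

namespace TDer

variable {A : Type} {ι : A} {D : Type} [CommRing D] {M : SignedCancellationMeadow D}

theorem eps_conj (x : TT A) : TDer A ι D M (TT.conj TT.eps x) x :=
  (t1 _ _).trans (t3 x)

/-- RICA without its zero test, for an interest rate `p` such that `(1+p)/(1+p) = 1` is valid. -/
theorem rica_of_valid {p : QT A} (hicfree : icFree p)
    (hp : ∀ ρ : ℕ → D,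
      evalNoIC M ρ (qdiv (QT.add QT.one p) (QT.add QT.one p)) = 1)
    (a : A) (v : QT A) (x : TT A) :
    TDer A ι D M (TT.ienc {a} p (TT.conj (TT.act a v) x))
      (TT.ienc {a} p
        (TT.conj (TT.delay (TT.act a (QT.mul (QT.add QT.one p) v))) x)) := by
  have hγ : TDer A ι D M
      (TT.gam (qsub QT.one (qdiv (QT.add QT.one p) (QT.add QT.one p)))) TT.eps := by
    refine (gam_congr (QDer.valid ?_ (by simp [icFree]) fun ρ => ?_)).trans t7
    · simp [qsub, qdiv, icFree, hicfree]
    · simp [qsub, evalNoIC, hp ρ]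
  have drop (y : TT A) := (conj_congr hγ (refl y)).trans (eps_conj y)
  exact ((drop _).symm.trans (rica a p v x)).trans (drop _)

/-- Encapsulation distributes over a conjunction whose second part it leaves unchanged. -/
theorem ienc_conj_of_fixed {H : Set A} {p : QT A} {x y : TT A}
    (hy : TDer A ι D M (TT.ienc H p y) y) :
    TDer A ι D M (TT.ienc H p (TT.conj x y)) (TT.conj (TT.ienc H p x) y) :=
  ((ienc_congr H (QDer.refl p) (conj_congr (refl x) hy.symm)).trans
    (ice6 H p x y)).trans (conj_congr (refl _) hy)

theorem ienc_delay_of_fixed {H : Set A} {p : QT A} {x : TT A}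
    (hx : TDer A ι D M (TT.ienc H p x) x) :
    TDer A ι D M (TT.ienc H p (TT.delay x)) (TT.delay x) :=
  (ice7 H p x).trans (delay_congr hx)

/-- Encapsulating a transfer now and a transfer one step later tests the sum of the first amount
and the discounted second amount. -/
theorem ienc_act_conj_delay_act {p q r : QT A} (hicfree : icFree p)
    (hp : ∀ ρ : ℕ → D,
      evalNoIC M ρ (qdiv (QT.add QT.one p) (QT.add QT.one p)) = 1)
    (hq : icFree q) (hr : icFree r) (a : A) :
    TDer A ι D M
      (TT.ienc {a} p (TT.conj (TT.act a q) (TT.delay (TT.act a r))))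
      (TT.gam (QT.add q (qdiv r (QT.add QT.one p)))) := by
  have hr' : QDer A ι D M r
      (QT.mul (QT.add QT.one p) (qdiv r (QT.add QT.one p))) := by
    refine QDer.valid hr (by simp [qdiv, icFree, hicfree, hr]) fun ρ => ?_
    have h := hp ρ
    simp only [qdiv, evalNoIC] at h ⊢
    rw [mul_left_comm, h, mul_one]
  have hsum : QDer A ι D M (QT.add (qdiv r (QT.add QT.one p)) q)
      (QT.add q (qdiv r (QT.add QT.one p))) :=
    QDer.valid (by simp [qdiv, icFree, hicfree, hq, hr])
      (by simp [qdiv, icFree, hicfree, hq, hr]) fun ρ => by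
        simp only [evalNoIC, add_comm]
  have hswap : TDer A ι D M
      (TT.conj (TT.act a q) (TT.delay (TT.act a r)))
      (TT.conj (TT.delay
        (TT.act a (QT.mul (QT.add QT.one p) (qdiv r (QT.add QT.one p)))))
        (TT.act a q)) :=
    (t1 _ _).trans (conj_congr (delay_congr (act_congr a hr')) (refl _))
  exact (ienc_congr _ (QDer.refl p) hswap).trans <|
    (rica_of_valid hicfree hp a _ _).symm.trans <|
    (ienc_congr _ (QDer.refl p) (t5 a _ _)).trans <|
    (ice5 _ p a _ (Set.mem_singleton a)).trans (gam_congr hsum)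

end TDer

/-- **Example 1.** Let `p` be a closed quantity term with `(1+p)/(1+p) = 1` valid in `D`,
and let `a` and `b` be distinct transfer actions different from `ι`.  Then
`ε^p_{a}(a(u) ⊓ σ(a(5)) ⊓ σ²(b(u − 7))) = γ(u + 5/(1+p)) ⊓ σ²(b(u − 7))`
is derivable from the axioms of TTC together with the proof rule DE
(`u` is a quantity variable; numerals abbreviate sums of `1`'s). -/
theorem ienc_example (A : Type) (ι : A) (D : Type) [CommRing D]
    (M : SignedCancellationMeadow D) (a b : A)
    (hab : a ≠ b) (haι : a ≠ ι) (hbι : b ≠ ι)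
    (p : QT A) (hclosed : closedQ p) (hicfree : icFree p)
    (hp : ∀ ρ : ℕ → D,
      evalNoIC M ρ (qdiv (QT.add QT.one p) (QT.add QT.one p)) = 1) :
    TDer A ι D M
      (TT.ienc {a} p
        (TT.conj
          (TT.conj (TT.act a (QT.var 0)) (TT.delay (TT.act a (qnum 5))))
          (TT.delay (TT.delay (TT.act b (qsub (QT.var 0) (qnum 7)))))))
      (TT.conj
        (TT.gam (QT.add (QT.var 0) (qdiv (qnum 5) (QT.add QT.one p))))
        (TT.delay (TT.delay (TT.act b (qsub (QT.var 0) (qnum 7)))))) := by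
  have hb : TDer A ι D M
      (TT.ienc {a} p (TT.act b (qsub (QT.var 0) (qnum 7))))
      (TT.act b (qsub (QT.var 0) (qnum 7))) :=
    TDer.ice4 _ p b _ fun h => hab h.symm
  exact (TDer.ienc_conj_of_fixed
    (TDer.ienc_delay_of_fixed (TDer.ienc_delay_of_fixed hb))).trans <|
    TDer.conj_congr
      (TDer.ienc_act_conj_delay_act hicfree hp (by simp [icFree])
        (by simp [qnum, icFree]) a)
      (TDer.refl _)
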